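/- arXiv:2603.27007 — 11 statements merged into one kernel-verified Lean document; each statement's English description precedes it below -/
import Mathlib

section
/- In any extensional 2-pointed magma satisfying both capability R and the classifier dichotomy, any retraction witness r is a non-classifier: there exists a core element x with r · x ∉ {z₁, z₂}; equivalently, r cannot be a classifier on core. -/
/-- An extensional 2-pointed magma: a finite carrier `S` with a binary
operation, two distinct left-absorbers `z1, z2`, no other left-absorbers,
and extensionality. -/
structure E2PM (S : Type*) [Fintype S] where
  op : S → S → S
  z1 : S
  z2 : S
  z_ne : z1 ≠ z2
  absorb1 : ∀ x, op z1 x = z1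
  absorb2 : ∀ x, op z2 x = z2
  no_other_absorber : ∀ a, (∀ x, op a x = a) → a = z1 ∨ a = z2
  extensional : ∀ a b, (∀ x, op a x = op b x) → a = b

namespace E2PM

variable {S : Type*} [Fintype S]

/-- The core: elements that are not absorbers. -/
def Core (M : E2PM S) (x : S) : Prop := x ≠ M.z1 ∧ x ≠ M.z2

/-- Absorber-valued: membership in `{z1, z2}`. -/
def AbsVal (M : E2PM S) (x : S) : Prop := x = M.z1 ∨ x = M.z2

/-- A retraction pair: core elements `s, r` with `r · (s · x) = x` on core
and `r · z1 = z1`. -/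
def RetractionPair (M : E2PM S) (s r : S) : Prop :=
  M.Core s ∧ M.Core r ∧ (∀ x, M.Core x → M.op r (M.op s x) = x) ∧
    M.op r M.z1 = M.z1

/-- Capability R: a retraction pair exists. -/
def CapR (M : E2PM S) : Prop := ∃ s r, M.RetractionPair s r

/-- `y` is a classifier on core: all products with core elements are
absorber-valued. -/
def ClassifierOnCore (M : E2PM S) (y : S) : Prop :=
  ∀ x, M.Core x → M.AbsVal (M.op y x)

/-- `y` is a non-classifier: no product with a core element is
absorber-valued. -/
def NonClassifier (M : E2PM S) (y : S) : Prop :=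
  ∀ x, M.Core x → ¬ M.AbsVal (M.op y x)

/-- Capability D, the classifier dichotomy: a classifier exists (absorber-
valued on all of `S`), every core element is a classifier on core or a
non-classifier, and a non-classifier exists. -/
def ClassifierDichotomy (M : E2PM S) : Prop :=
  (∃ τ, M.Core τ ∧ ∀ x, M.AbsVal (M.op τ x)) ∧
  (∀ y, M.Core y → M.ClassifierOnCore y ∨ M.NonClassifier y) ∧
  (∃ y, M.Core y ∧ M.NonClassifier y)

/-- An ICP witness triple: pairwise distinct core elements `a, b, c` with
`b` core-preserving, `a · x = c · (b · x)` on core, and `a` taking at least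
two distinct values on core. -/
def ICPWitness (M : E2PM S) (a b c : S) : Prop :=
  M.Core a ∧ M.Core b ∧ M.Core c ∧ a ≠ b ∧ a ≠ c ∧ b ≠ c ∧
  (∀ x, M.Core x → M.Core (M.op b x)) ∧
  (∀ x, M.Core x → M.op a x = M.op c (M.op b x)) ∧
  (∃ x y, M.Core x ∧ M.Core y ∧ M.op a x ≠ M.op a y)

/-- Capability H, the Internal Composition Property. -/
def ICP (M : E2PM S) : Prop := ∃ a b c, M.ICPWitness a b c

/-- Weakened ICP witness: pairwise-distinctness dropped. -/
def ICPWitnessNoDistinct (M : E2PM S) (a b c : S) : Prop :=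
  M.Core a ∧ M.Core b ∧ M.Core c ∧
  (∀ x, M.Core x → M.Core (M.op b x)) ∧
  (∀ x, M.Core x → M.op a x = M.op c (M.op b x)) ∧
  (∃ x y, M.Core x ∧ M.Core y ∧ M.op a x ≠ M.op a y)

/-- Weakened ICP witness: non-triviality dropped. -/
def ICPWitnessNoNontrivial (M : E2PM S) (a b c : S) : Prop :=
  M.Core a ∧ M.Core b ∧ M.Core c ∧ a ≠ b ∧ a ≠ c ∧ b ≠ c ∧
  (∀ x, M.Core x → M.Core (M.op b x)) ∧
  (∀ x, M.Core x → M.op a x = M.op c (M.op b x))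

end E2PM

/-- With capabilities R and D, any retraction witness `r` is a
non-classifier: some core `x` has `r · x ∉ {z1, z2}`; equivalently `r` is not
a classifier on core. -/
theorem retraction_witness_is_nonclassifier {S : Type*} [Fintype S]
    (M : E2PM S) (hD : M.ClassifierDichotomy)
    (s r : S) (hsr : M.RetractionPair s r) :
    (∃ x, M.Core x ∧ ¬ M.AbsVal (M.op r x)) ∧ ¬ M.ClassifierOnCore r := by
  have hr : ¬ M.ClassifierOnCore r := by
    obtain ⟨⟨τ, hτ, hτv⟩, -, y, hy, hyn⟩ := hD
    obtain ⟨-, -, hret, hz1⟩ := hsr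
    intro hcl
    have key : ∀ x, M.Core x → x = M.op r M.z2 := by
      intro x hx
      have hrx := hret x hx
      by_cases h1 : M.op s x = M.z1
      · rw [h1, hz1] at hrx
        exact absurd hrx.symm hx.1
      by_cases h2 : M.op s x = M.z2
      · rw [← h2, hrx]
      · have h := hcl _ ⟨h1, h2⟩
        rw [hrx] at h
        exact absurd h (not_or.mpr hx)
    have hyτ : y = τ := (key y hy).trans (key τ hτ).symm
    exact hyn y hy (hyτ ▸ hτv y)
  refine ⟨?_, hr⟩
  by_contra! h
  exact hr h
end

section
/- Every extensional 2-pointed magma satisfying the classifier dichotomy and carrying a mutual-inverse retraction pair with s ≠ r (core elements s, r with r · (s · x) = x and s · (r · x) = x for all core x, and r · z₁ = z₁) has at least 5 elements: |S| ≥ 5. -/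
/-- With the classifier dichotomy and a mutual-inverse retraction
pair with `s ≠ r`, the carrier has at least 5 elements. -/
theorem card_ge_five {S : Type*} [Fintype S] (M : E2PM S)
    (hD : M.ClassifierDichotomy) (s r : S)
    (hs : M.Core s) (hr : M.Core r) (hne : s ≠ r)
    (hrs : ∀ x, M.Core x → M.op r (M.op s x) = x)
    (hsr : ∀ x, M.Core x → M.op s (M.op r x) = x)
    (hanchor : M.op r M.z1 = M.z1) :
    5 ≤ Fintype.card S := by
  classical
  obtain ⟨⟨τ, hτ, habs⟩, -, -⟩ := hD
  have hτs : τ ≠ s := by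
    rintro rfl
    have h := habs (M.op r τ)
    rw [hsr τ hs] at h
    exact h.elim hs.1 hs.2
  have hτr : τ ≠ r := by
    rintro rfl
    have h := habs (M.op s τ)
    rw [hrs τ hr] at h
    exact h.elim hr.1 hr.2
  have hcard : ({M.z1, M.z2, s, r, τ} : Finset S).card = 5 := by
    simp [Finset.card_insert_of_notMem, M.z_ne, hs.1.symm, hs.2.symm, hr.1.symm, hr.2.symm,
      hτ.1.symm, hτ.2.symm, hne, hτs.symm, hτr.symm]
  exact hcard ▸ Finset.card_le_univ _
end

section
/- No extensional 2-pointed magma carrying both a classifier and a retraction pair is associative: if there is a core element τ with τ · x ∈ {z₁, z₂} for all x ∈ S, and core elements s, r with r · (s · x) = x for all core x, then the operation · does not satisfy (a · b) · c = a · (b · c) for all a, b, c ∈ S. In particular, no such magma is a semigroup. -/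
/-- No extensional 2-pointed magma carrying both a classifier and
a retraction pair is associative. -/
theorem no_associativity {S : Type*} [Fintype S] (M : E2PM S)
    (τ : S) (hτ : M.Core τ) (hcl : ∀ x, M.AbsVal (M.op τ x))
    (s r : S) (hs : M.Core s) (hr : M.Core r)
    (hret : ∀ x, M.Core x → M.op r (M.op s x) = x) :
    ¬ ∀ a b c : S, M.op (M.op a b) c = M.op a (M.op b c) := by
  intro assoc
  have absorb : ∀ {y}, M.AbsVal y → ∀ x, M.op y x = y := by
    rintro y (rfl | rfl) x
    · exact M.absorb1 x
    · exact M.absorb2 x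
  have left_invariant : ∀ x y, M.op τ (M.op x y) = M.op τ x := fun x y => by
    rw [← assoc, absorb (hcl x)]
  have core_value : ∀ x, M.Core x → M.op τ x = M.op τ r := fun x hx => by
    rw [← hret x hx, left_invariant]
  have square : ∀ x, M.op τ (M.op τ x) = M.op τ r := fun x => by
    rw [left_invariant, core_value τ hτ]
  have const : ∀ x, M.op τ x = M.op τ r := by
    intro x
    have h1 := square M.z1
    have h2 := square M.z2
    have c1 := hcl M.z1
    have c2 := hcl M.z2
    have cr := hcl r
    by_cases hx : M.Core x
    · exact core_value x hx
    · unfold E2PM.Core at hx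
      unfold E2PM.AbsVal at c1 c2 cr
      grind
  have eq_value : τ = M.op τ r := M.extensional _ _ fun x => by
    rw [const x, absorb (hcl r)]
  rcases hcl r with h | h
  · exact hτ.1 (eq_value.trans h)
  · exact hτ.2 (eq_value.trans h)
end

section
/- K-infinity: if A is a set with a total binary operation · containing an element k satisfying (k · a) · b = a for all a, b ∈ A, and A has at least two elements, then A is infinite. Equivalently, no finite set with at least two elements carries a total binary operation with such an element k. -/
/-- K-infinity: if a set with a total binary operation contains
a K-combinator (`(k · a) · b = a` for all `a, b`) and has at least two
elements, it is infinite. -/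
theorem k_infinity {A : Type*} (op : A → A → A) (k : A)
    (hk : ∀ a b, op (op k a) b = a) (h2 : ∃ a b : A, a ≠ b) :
    Infinite A := by
  by_contra hA
  rw [not_infinite_iff_finite] at hA
  have hinj : Function.Injective (op k) := fun a b h => by
    rw [← hk a k, h, hk b k]
  obtain ⟨c, hc⟩ := Finite.surjective_of_injective hinj k
  have hconst : ∀ b, op k b = c := fun b => by
    simpa only [hc] using hk c b
  obtain ⟨a, b, hab⟩ := h2
  exact hab (hinj ((hconst a).trans (hconst b).symm))
end

section
/- Necessity of non-triviality in the ICP: there exists an extensional 2-pointed magma of size 6 carrying a retraction pair that satisfies the weakened Internal Composition Property obtained by dropping the requirement that a take at least two distinct values on the core, yet does not satisfy the full Internal Composition Property. -/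
namespace E2PM

/-- A six-element magma with absorbers `0` and `1`. The element `2` acts as the identity, while
`3`, `4` and `5` are constant on the core. -/
def identityWithConstants : E2PM (Fin 6) where
  op a x := ![![0, 0, 0, 0, 0, 0],
              ![1, 1, 1, 1, 1, 1],
              ![0, 1, 2, 3, 4, 5],
              ![1, 0, 0, 0, 0, 0],
              ![1, 1, 0, 0, 0, 0],
              ![0, 0, 1, 1, 1, 1]] a x
  z1 := 0
  z2 := 1
  z_ne := by decide
  absorb1 := by decide
  absorb2 := by decide
  no_other_absorber := by decide
  extensional := by decide

lemma identityWithConstants_op_eq {a x y : Fin 6} (ha : identityWithConstants.Core a)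
    (h2 : a ≠ 2) (hx : identityWithConstants.Core x) (hy : identityWithConstants.Core y) :
    identityWithConstants.op a x = identityWithConstants.op a y := by
  revert a x y
  unfold Core
  decide

end E2PM

/-- Necessity of non-triviality in the ICP: a size-6 extensional
2-pointed magma with a retraction pair satisfies the weakened ICP
(non-triviality dropped) but not the full ICP. -/
theorem icp_nontrivial_necessary :
    ∃ M : E2PM (Fin 6), (∃ s r, M.RetractionPair s r) ∧
      (∃ a b c, M.ICPWitnessNoNontrivial a b c) ∧ ¬ M.ICP := by
  refine ⟨E2PM.identityWithConstants, ⟨2, 2, ?_⟩, ⟨3, 2, 4, ?_⟩, ?_⟩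
  · unfold E2PM.RetractionPair E2PM.Core
    decide
  · unfold E2PM.ICPWitnessNoNontrivial E2PM.Core
    decide
  · rintro ⟨a, b, c, ha, -, hc, -, hac, -, hpres, hcomp, x, y, hx, hy, hxy⟩
    have ha2 : a = 2 := by
      by_contra h
      exact hxy (E2PM.identityWithConstants_op_eq ha h hx hy)
    rw [hcomp x hx, hcomp y hy] at hxy
    exact hxy (E2PM.identityWithConstants_op_eq hc (fun h => hac (ha2.trans h.symm))
      (hpres x hx) (hpres y hy))
end

section
/- R does not imply H (structurally): there exists an extensional 2-pointed magma of size 6, whose core has 4 elements (strictly more than the 3 pairwise distinct witnesses the ICP requires), that carries a retraction pair (capability R) but does not satisfy the Internal Composition Property. -/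
/-- The elements `2` and `3` act on the core `{2, 3, 4, 5}` as a 4-cycle and its inverse; `4` and `5`
are constant on the core, with absorber values. -/
def cyclicMagma : E2PM (Fin 6) where
  op := ![![0, 0, 0, 0, 0, 0],
         ![1, 1, 1, 1, 1, 1],
         ![0, 1, 3, 4, 5, 2],
         ![0, 1, 5, 2, 3, 4],
         ![1, 1, 0, 0, 0, 0],
         ![0, 0, 1, 1, 1, 1]]
  z1 := 0
  z2 := 1
  z_ne := by decide
  absorb1 := by decide
  absorb2 := by decide
  no_other_absorber := by decide
  extensional := by decide

/-- R does not imply H (structurally): a size-6 extensional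
2-pointed magma whose core has 4 elements carries a retraction pair but does
not satisfy the ICP. -/
theorem r_not_implies_h :
    ∃ M : E2PM (Fin 6),
      (Finset.univ.filter (fun x => x ≠ M.z1 ∧ x ≠ M.z2)).card = 4 ∧
      M.CapR ∧ ¬ M.ICP := by
  refine ⟨cyclicMagma, by decide, ⟨2, 3, ?_⟩, ?_⟩
  · unfold E2PM.RetractionPair E2PM.Core
    decide
  · unfold E2PM.ICP E2PM.ICPWitness E2PM.Core
    decide +kernel
end

section
/- D does not imply H (structurally): there exists an extensional 2-pointed magma of size 10, whose core has 8 elements, that satisfies both the classifier dichotomy (capability D) and capability R, yet does not satisfy the Internal Composition Property: no triple of pairwise distinct core elements (a, b, c) satisfies the ICP conditions. -/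
/-- A multiplication on `Fin 10` in which `2` acts as the identity, `3` is a classifier,
and every other element acts by a constant. -/
def constantRowsOp (y x : Fin 10) : Fin 10 :=
  if y = 2 then x
  else if y = 3 then if x = 0 then 1 else 0
  else if y ≤ 1 then y
  else y - 1

/-- The extensional 2-pointed magma with multiplication `constantRowsOp` and
absorbers `0` and `1`. -/
def constantRowsMagma : E2PM (Fin 10) where
  op := constantRowsOp
  z1 := 0
  z2 := 1
  z_ne := by decide
  absorb1 := by decide
  absorb2 := by decide
  no_other_absorber := by decide
  extensional := by decide

theorem constantRowsOp_eq_of_ne_two :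
    ∀ y, y ≠ 2 → ∀ x, x ≠ 0 → constantRowsOp y x = constantRowsOp y 2 := by
  decide

/-- The only element acting non-constantly on the core is `2`, and a composite whose inner
factor is another element is constant on the core. -/
theorem not_icp_constantRowsMagma : ¬ constantRowsMagma.ICP := by
  rintro ⟨a, b, c, -, -, -, hab, -, -, -, hcomp, x, y, hx, hy, hxy⟩
  by_cases ha : a = 2
  · have hb : b ≠ 2 := fun hb => hab (ha.trans hb.symm)
    have hbxy : constantRowsMagma.op b x = constantRowsMagma.op b y :=
      (constantRowsOp_eq_of_ne_two b hb x hx.1).trans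
        (constantRowsOp_eq_of_ne_two b hb y hy.1).symm
    exact hxy (by rw [hcomp x hx, hcomp y hy, hbxy])
  · exact hxy ((constantRowsOp_eq_of_ne_two a ha x hx.1).trans
      (constantRowsOp_eq_of_ne_two a ha y hy.1).symm)

/-- D does not imply H (structurally): a size-10 extensional
2-pointed magma whose core has 8 elements satisfies D and R but not the ICP. -/
theorem d_not_implies_h :
    ∃ M : E2PM (Fin 10),
      (Finset.univ.filter (fun x => x ≠ M.z1 ∧ x ≠ M.z2)).card = 8 ∧
      M.ClassifierDichotomy ∧ M.CapR ∧ ¬ M.ICP := by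
  refine ⟨constantRowsMagma, by decide, ⟨⟨3, ?_, ?_⟩, ?_, 2, ?_, ?_⟩, ⟨2, 2, ?_, ?_, ?_, rfl⟩,
    not_icp_constantRowsMagma⟩ <;>
  simp only [E2PM.Core, E2PM.AbsVal, E2PM.ClassifierOnCore, E2PM.NonClassifier] <;>
  decide
end

section
/- H does not imply D (tight at size 5): there exists an extensional 2-pointed magma of size 5 that satisfies the Internal Composition Property but has no classifier: no core element τ satisfies τ · x ∈ {z₁, z₂} for all core x; in particular the classifier dichotomy fails. -/
/-- A size-5 magma with absorbers `0, 1` in which the core `{2, 3, 4}` is closed under the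
operation, and `2 · x = 4 · (3 · x)` on the core. -/
def E2PM.coreClosedWitness : E2PM (Fin 5) where
  op x y :=
    ![![0, 0, 0, 0, 0], ![1, 1, 1, 1, 1], ![0, 0, 2, 3, 2], ![0, 0, 3, 4, 2], ![0, 0, 2, 2, 3]] x y
  z1 := 0
  z2 := 1
  z_ne := by decide
  absorb1 := by decide
  absorb2 := by decide
  no_other_absorber := by decide
  extensional := by decide

/-- H does not imply D (tight at size 5): a size-5 extensional
2-pointed magma satisfies the ICP but has no classifier on core; in particular
the classifier dichotomy fails. -/
theorem h_not_implies_d :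
    ∃ M : E2PM (Fin 5), M.ICP ∧
      (¬ ∃ τ, M.Core τ ∧ M.ClassifierOnCore τ) ∧
      ¬ M.ClassifierDichotomy := by
  have not_classifier : ∀ τ, E2PM.coreClosedWitness.Core τ →
      ¬ E2PM.coreClosedWitness.ClassifierOnCore τ := by
    unfold E2PM.ClassifierOnCore E2PM.Core E2PM.AbsVal
    decide
  refine ⟨E2PM.coreClosedWitness, ⟨2, 3, 4, ?_⟩, fun ⟨τ, hτ, h⟩ => not_classifier τ hτ h,
    fun ⟨⟨τ, hτ, h⟩, _⟩ => not_classifier τ hτ fun x _ => h x⟩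
  unfold E2PM.ICPWitness E2PM.Core
  decide
end

section
/- D does not imply R (tight at size 4): there exists an extensional 2-pointed magma of size 4 that satisfies the classifier dichotomy but admits no retraction pair: no pair of core elements s, r satisfies r · (s · x) = x for all core x together with r · z₁ = z₁. -/
/-- A four-element magma with absorbers `0, 1`, a classifier `2` recognizing `0`, and a
non-classifier `3` constantly equal to `2`. -/
def constClassifierMagma : E2PM (Fin 4) where
  op a x := ![0, 1, if x = 0 then 1 else 0, 2] a
  z1 := 0
  z2 := 1
  z_ne := by decide
  absorb1 := by decide
  absorb2 := by decide
  no_other_absorber := by decide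
  extensional := by decide

/-- D does not imply R (tight at size 4): a size-4 extensional
2-pointed magma satisfies the classifier dichotomy but admits no retraction
pair. -/
theorem d_not_implies_r :
    ∃ M : E2PM (Fin 4), M.ClassifierDichotomy ∧
      ¬ ∃ s r, M.RetractionPair s r := by
  refine ⟨constClassifierMagma, ?_, ?_⟩
  · unfold E2PM.ClassifierDichotomy E2PM.ClassifierOnCore E2PM.NonClassifier E2PM.Core
      E2PM.AbsVal constClassifierMagma
    decide
  · unfold E2PM.RetractionPair E2PM.Core constClassifierMagma
    decide
end

section
/- No ICP at size 4, and H does not imply R at size 5: (i) no extensional 2-pointed magma of size 4 satisfies the Internal Composition Property (its core has only 2 elements while the ICP requires 3 pairwise distinct core elements); (ii) there exists an extensional 2-pointed magma of size 5 that satisfies the Internal Composition Property but admits no retraction pair. -/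
/-- A size-five magma satisfying the ICP in which no core element fixes the first absorber. -/
def hNotRMagma : E2PM (Fin 5) where
  op := ![![0, 0, 0, 0, 0], ![1, 1, 1, 1, 1], ![1, 1, 1, 0, 0], ![1, 1, 3, 2, 2], ![1, 1, 0, 1, 0]]
  z1 := 0
  z2 := 1
  z_ne := by decide
  absorb1 := by decide
  absorb2 := by decide
  no_other_absorber := by decide
  extensional := by decide

theorem E2PM.ICP.five_le_card {S : Type*} [Fintype S] {M : E2PM S} (h : M.ICP) :
    5 ≤ Fintype.card S := by
  classical
  obtain ⟨a, b, c, ha, hb, hc, hab, hac, hbc, -⟩ := h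
  have hcard : ({M.z1, M.z2, a, b, c} : Finset S).card = 5 := by
    rw [Finset.card_insert_of_notMem, Finset.card_insert_of_notMem, Finset.card_insert_of_notMem,
      Finset.card_pair hbc]
    · simp [hab, hac]
    · simp [ha.2.symm, hb.2.symm, hc.2.symm]
    · simp [M.z_ne, ha.1.symm, hb.1.symm, hc.1.symm]
  exact hcard ▸ Finset.card_le_univ _

theorem hNotRMagma_icp : hNotRMagma.ICP := by
  unfold E2PM.ICP E2PM.ICPWitness E2PM.Core
  exact ⟨2, 3, 4, by decide⟩

theorem hNotRMagma_not_capR : ¬ hNotRMagma.CapR := by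
  rintro ⟨-, r, -, hr, -, hfix⟩
  have key : ∀ r : Fin 5, r ≠ hNotRMagma.z1 → hNotRMagma.op r hNotRMagma.z1 ≠ hNotRMagma.z1 := by
    decide
  exact key r hr.1 hfix

/-- (i) no extensional 2-pointed magma of size 4 satisfies the
ICP; (ii) a size-5 extensional 2-pointed magma satisfies the ICP but admits no
retraction pair. -/
theorem no_icp_at_four_and_h_not_implies_r :
    (∀ (S : Type) [Fintype S], Fintype.card S = 4 → ∀ M : E2PM S, ¬ M.ICP) ∧
    (∃ M : E2PM (Fin 5), M.ICP ∧ ¬ M.CapR) := by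
  refine ⟨fun S _ hS M h => ?_, hNotRMagma, hNotRMagma_icp, hNotRMagma_not_capR⟩
  have := h.five_le_card
  omega
end

section
/- Optimal coexistence: there exists an extensional 2-pointed magma of size 5 that simultaneously satisfies capability R (a retraction pair exists), the classifier dichotomy (capability D), and the Internal Composition Property (capability H); moreover 5 is optimal, since no extensional 2-pointed magma of size at most 4 satisfies the Internal Composition Property. -/
namespace E2PM

/-- A size-5 magma with absorbers `0`, `1`, classifiers `2`, `3`, and an element `4` acting on the
core as the transposition of `2` and `3`. -/
def coexistenceMagma : E2PM (Fin 5) where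
  op := ![![0, 0, 0, 0, 0], ![1, 1, 1, 1, 1], ![0, 0, 0, 1, 0], ![0, 0, 1, 0, 0], ![0, 0, 3, 2, 4]]
  z1 := 0
  z2 := 1
  z_ne := by decide
  absorb1 := by decide
  absorb2 := by decide
  no_other_absorber := by decide
  extensional := by decide

theorem coexistenceMagma_capR : coexistenceMagma.CapR := by
  refine ⟨4, 4, ?_⟩
  unfold RetractionPair Core
  decide

theorem coexistenceMagma_classifierDichotomy : coexistenceMagma.ClassifierDichotomy := by
  unfold ClassifierDichotomy ClassifierOnCore NonClassifier Core AbsVal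
  decide

theorem coexistenceMagma_icp : coexistenceMagma.ICP := by
  refine ⟨3, 4, 2, ?_⟩
  unfold ICPWitness Core
  decide

/-- The two absorbers and an ICP witness triple are five distinct elements. -/
theorem ICP.five_le_card_s19 {S : Type*} [Fintype S] {M : E2PM S} (h : M.ICP) :
    5 ≤ Fintype.card S := by
  classical
  obtain ⟨a, b, c, ⟨ha₁, ha₂⟩, ⟨hb₁, hb₂⟩, ⟨hc₁, hc₂⟩, hab, hac, hbc, -⟩ := h
  have hcard : ({a, b, c, M.z1, M.z2} : Finset S).card = 5 := by
    simp [Finset.card_insert_of_notMem, M.z_ne, *]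
  exact hcard ▸ Finset.card_le_univ _

end E2PM

/-- Optimal coexistence: a size-5 extensional 2-pointed magma
satisfies R, D, and H simultaneously, and 5 is optimal: no extensional
2-pointed magma of size at most 4 satisfies the ICP. -/
theorem optimal_coexistence :
    (∃ M : E2PM (Fin 5), M.CapR ∧ M.ClassifierDichotomy ∧ M.ICP) ∧
    (∀ (S : Type) [Fintype S], Fintype.card S ≤ 4 → ∀ M : E2PM S, ¬ M.ICP) :=
  ⟨⟨E2PM.coexistenceMagma, E2PM.coexistenceMagma_capR,
    E2PM.coexistenceMagma_classifierDichotomy, E2PM.coexistenceMagma_icp⟩,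
    fun _ _ hS _ hM => absurd (hM.five_le_card_s19.trans hS) (by decide)⟩
end
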